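/- Fix κ ∈ (0,1), q ∈ [0,1], w > 0, and a finite Borel measure μ on [0,1] having a continuous, everywhere positive density with respect to Lebesgue measure. If (f*,a*) is a pure-strategy Nash equilibrium with implied probability P* = P^{f*,a*}, then d₁* = ∫₀¹ f₁* dμ = μ((P*/κ, 1]) and d₂* = ∫₀¹ f₂* dμ = μ([0, 1 − (1−P*)/κ)). -/

import Mathlib

open MeasureTheory Set

noncomputable section

/-- `μ` is a finite Borel measure on `[0,1]` with a continuous, everywhere positive
density with respect to Lebesgue measure. -/
def NiceDensity (μ : Measure ℝ) : Prop :=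
  ∃ g : ℝ → ℝ, ContinuousOn g (Icc 0 1) ∧ (∀ p ∈ Icc (0:ℝ) 1, 0 < g p) ∧
    μ = (volume.restrict (Icc (0:ℝ) 1)).withDensity (fun p => ENNReal.ofReal (g p))

/-- Total amount wagered by the diffuse players on Outcome 1. -/
def d1 (μ : Measure ℝ) (f : ℝ → ℝ × ℝ) : ℝ := ∫ p in Icc (0:ℝ) 1, (f p).1 ∂μ

/-- Total amount wagered by the diffuse players on Outcome 2. -/
def d2 (μ : Measure ℝ) (f : ℝ → ℝ × ℝ) : ℝ := ∫ p in Icc (0:ℝ) 1, (f p).2 ∂μ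

/-- The implied probability of Outcome 1, `P^{f,a}`. -/
def impliedProb (μ : Measure ℝ) (f : ℝ → ℝ × ℝ) (a : ℝ × ℝ) : ℝ :=
  (d1 μ f + a.1) / (d1 μ f + d2 μ f + a.1 + a.2)

/-- A feasible strategy profile for the diffuse players. -/
def FeasibleDiffuse (f : ℝ → ℝ × ℝ) : Prop :=
  Measurable f ∧ ∀ p ∈ Icc (0:ℝ) 1, 0 ≤ (f p).1 ∧ 0 ≤ (f p).2 ∧ (f p).1 + (f p).2 ≤ 1

/-- A feasible strategy profile for the atomic player. -/
def FeasibleAtomic (w : ℝ) (a : ℝ × ℝ) : Prop := 0 ≤ a.1 ∧ 0 ≤ a.2 ∧ a.1 + a.2 ≤ w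

/-- The expected profit of a bettor who believes Outcome 1 occurs with probability `p`,
betting `b1` on Outcome 1 and `b2` on Outcome 2, when the implied probability of
Outcome 1 is `P` (with the indicator conventions of the paper). -/
def payoff (κ P p b1 b2 : ℝ) : ℝ :=
  b1 * ((if P = 0 then 0 else κ * p / P) - 1) +
  b2 * ((if P = 1 then 0 else κ * (1 - p) / (1 - P)) - 1)

/-- A pure-strategy Nash equilibrium. -/
def IsEquilibrium (κ q w : ℝ) (μ : Measure ℝ) (f : ℝ → ℝ × ℝ) (a : ℝ × ℝ) : Prop :=
  FeasibleDiffuse f ∧ FeasibleAtomic w a ∧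
  0 < d1 μ f + d2 μ f + a.1 + a.2 ∧
  (∀ p ∈ Icc (0:ℝ) 1,
    payoff κ (impliedProb μ f a) p (f p).1 (f p).2 =
      sSup {x | ∃ b1 b2 : ℝ, 0 ≤ b1 ∧ 0 ≤ b2 ∧ b1 + b2 ≤ 1 ∧
        x = payoff κ (impliedProb μ f a) p b1 b2}) ∧
  payoff κ (impliedProb μ f a) q a.1 a.2 =
    sSup {x | ∃ b1 b2 : ℝ, 0 ≤ b1 ∧ 0 ≤ b2 ∧ b1 + b2 ≤ w ∧
      0 < d1 μ f + d2 μ f + b1 + b2 ∧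
      x = payoff κ (impliedProb μ f (b1, b2)) q b1 b2}



lemma diffuse_opt (κ P p f1 f2 : ℝ)
    (h : payoff κ P p f1 f2 = sSup {x | ∃ b1 b2 : ℝ, 0 ≤ b1 ∧ 0 ≤ b2 ∧ b1 + b2 ≤ 1 ∧
        x = payoff κ P p b1 b2}) (b1 b2 : ℝ) (h1 : 0 ≤ b1) (h2 : 0 ≤ b2) (h3 : b1 + b2 ≤ 1) :
    payoff κ P p b1 b2 ≤ payoff κ P p f1 f2 := by
  rw [h]
  refine le_csSup ?_ ⟨b1, b2, h1, h2, h3, rfl⟩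
  refine ⟨|(if P = 0 then 0 else κ * p / P) - 1| +
    |(if P = 1 then 0 else κ * (1 - p) / (1 - P)) - 1|, ?_⟩
  rintro x ⟨c1, c2, k1, k2, k3, rfl⟩
  unfold payoff
  generalize (if P = 0 then 0 else κ * p / P) - 1 = u
  generalize (if P = 1 then 0 else κ * (1 - p) / (1 - P)) - 1 = v
  have e1 : c1 * u ≤ |u| := by
    nlinarith [le_abs_self u, abs_nonneg u]
  have e2 : c2 * v ≤ |v| := by
    nlinarith [le_abs_self v, abs_nonneg v]
  linarith

lemma lin_opt (u v f1 f2 : ℝ) (h1 : 0 ≤ f1) (h2 : 0 ≤ f2) (h3 : f1 + f2 ≤ 1)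
    (h : ∀ b1 b2 : ℝ, 0 ≤ b1 → 0 ≤ b2 → b1 + b2 ≤ 1 → b1 * u + b2 * v ≤ f1 * u + f2 * v) :
    (u < 0 → f1 = 0) ∧ (v < 0 → f2 = 0) ∧ (0 < u → v < 0 → f1 = 1) ∧
      (0 < v → u < 0 → f2 = 1) := by
  have A : u < 0 → f1 = 0 := by
    intro hu
    have := h 0 f2 le_rfl h2 (by linarith)
    nlinarith
  have B : v < 0 → f2 = 0 := by
    intro hu
    have := h f1 0 h1 le_rfl (by linarith)
    nlinarith
  refine ⟨A, B, ?_, ?_⟩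
  · intro hu hv
    have h4 := B hv
    have := h 1 0 (by norm_num) le_rfl (by norm_num)
    subst h4
    nlinarith
  · intro hv hu
    have h4 := A hu
    have := h 0 1 le_rfl (by norm_num) (by norm_num)
    subst h4
    nlinarith

/-- With no diffuse bets, every nonzero bet of the atomic player has nonpositive payoff. -/
lemma atomic_nonpos (κ q b1 b2 : ℝ) (hκ : κ ∈ Ioo (0:ℝ) 1) (hq : q ∈ Icc (0:ℝ) 1)
    (h1 : 0 ≤ b1) (h2 : 0 ≤ b2) (h3 : 0 < b1 + b2) :
    payoff κ (b1 / (b1 + b2)) q b1 b2 ≤ 0 := by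
  obtain ⟨k0, k1⟩ := hκ
  obtain ⟨q0, q1⟩ := hq
  have e1 : b1 * ((if b1 / (b1 + b2) = 0 then 0 else κ * q / (b1 / (b1 + b2))) - 1)
      ≤ κ * q * (b1 + b2) - b1 := by
    split_ifs with hP
    · have : 0 ≤ κ * q * (b1 + b2) := by positivity
      linarith
    · have : b1 ≠ 0 := by rintro rfl; simp at hP
      apply le_of_eq
      field_simp
  have e2 : b2 * ((if b1 / (b1 + b2) = 1 then 0 else
      κ * (1 - q) / (1 - b1 / (b1 + b2))) - 1) ≤ κ * (1 - q) * (b1 + b2) - b2 := by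
    have hq' : 0 ≤ 1 - q := by linarith
    split_ifs with hP
    · have : 0 ≤ κ * (1 - q) * (b1 + b2) := by positivity
      linarith
    · have hb : b2 ≠ 0 := by
        rintro rfl
        apply hP
        rw [add_zero] at *
        exact div_self h3.ne'
      have : 1 - b1 / (b1 + b2) = b2 / (b1 + b2) := by field_simp; ring
      rw [this]
      apply le_of_eq
      field_simp
  unfold payoff
  nlinarith

lemma atomic_opt (κ q w : ℝ) (μ : Measure ℝ) (f : ℝ → ℝ × ℝ) (a : ℝ × ℝ)
    (hκ : κ ∈ Ioo (0:ℝ) 1) (hq : q ∈ Icc (0:ℝ) 1)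
    (hd1 : d1 μ f = 0) (hd2 : d2 μ f = 0)
    (h : payoff κ (impliedProb μ f a) q a.1 a.2 =
    sSup {x | ∃ b1 b2 : ℝ, 0 ≤ b1 ∧ 0 ≤ b2 ∧ b1 + b2 ≤ w ∧
      0 < d1 μ f + d2 μ f + b1 + b2 ∧
      x = payoff κ (impliedProb μ f (b1, b2)) q b1 b2})
    (b1 b2 : ℝ) (h1 : 0 ≤ b1) (h2 : 0 ≤ b2) (h3 : b1 + b2 ≤ w) (h4 : 0 < b1 + b2) :
    payoff κ (b1 / (b1 + b2)) q b1 b2 ≤ payoff κ (impliedProb μ f a) q a.1 a.2 := by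
  rw [h]
  simp only [impliedProb, hd1, hd2, zero_add]
  refine le_csSup ⟨0, ?_⟩ ⟨b1, b2, h1, h2, h3, h4, rfl⟩
  rintro x ⟨c1, c2, m1, m2, m3, m4, rfl⟩
  exact atomic_nonpos κ q c1 c2 hκ hq m1 m2 m4

/-- In equilibrium, the diffuse players' totals are exactly the `μ`-masses of the
betting regions determined by the implied probability. -/
theorem stmt_11 (κ q w : ℝ) (hκ : κ ∈ Ioo (0:ℝ) 1) (hq : q ∈ Icc (0:ℝ) 1) (hw : 0 < w)
    (μ : Measure ℝ) (hμ : NiceDensity μ)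
    (f : ℝ → ℝ × ℝ) (a : ℝ × ℝ) (h : IsEquilibrium κ q w μ f a) :
    d1 μ f = (μ (Ioc (impliedProb μ f a / κ) 1)).toReal ∧
      d2 μ f = (μ (Ico 0 (1 - (1 - impliedProb μ f a) / κ))).toReal := by
  obtain ⟨⟨hfm, hff⟩, ⟨ha1, ha2, haw⟩, hpos, hdiff, hat⟩ := h
  have hk := hκ
  have hq' := hq
  obtain ⟨k0, k1⟩ := hk
  obtain ⟨q0, q1⟩ := hq'
  have hd1 : 0 ≤ d1 μ f := setIntegral_nonneg measurableSet_Icc (fun p hp => (hff p hp).1)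
  have hd2 : 0 ≤ d2 μ f := setIntegral_nonneg measurableSet_Icc (fun p hp => (hff p hp).2.1)
  have hopt : ∀ p ∈ Icc (0:ℝ) 1, _ := fun p hp =>
    lin_opt _ _ (f p).1 (f p).2 (hff p hp).1 (hff p hp).2.1 (hff p hp).2.2
      (diffuse_opt κ (impliedProb μ f a) p (f p).1 (f p).2 (hdiff p hp))
  have hP0 : 0 ≤ impliedProb μ f a := by unfold impliedProb; positivity
  have hP1 : impliedProb μ f a ≤ 1 := by
    unfold impliedProb; rw [div_le_one hpos]; linarith
  have hPne0 : impliedProb μ f a ≠ 0 := by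
    intro hP
    simp only [hP] at hopt
    have z1 : d1 μ f = 0 := by
      refine setIntegral_eq_zero_of_forall_eq_zero fun p hp => (hopt p hp).1 ?_
      simp
    have z2 : d2 μ f = 0 := by
      refine setIntegral_eq_zero_of_forall_eq_zero fun p hp => (hopt p hp).2.1 ?_
      obtain ⟨p0, p1⟩ := hp
      norm_num
      nlinarith
    have za : a.1 = 0 := by
      have := hP
      unfold impliedProb at this
      rw [div_eq_zero_iff] at this
      rcases this with h | h <;> linarith
    have hpa : 0 < a.2 := by linarith
    have := atomic_opt κ q w μ f a hκ hq z1 z2 hat 0 (a.2 / 2) le_rfl (by linarith)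
      (by linarith) (by linarith)
    rw [hP, za] at this
    simp [payoff] at this
    have hc : κ * (1 - q) - 1 < 0 := by nlinarith
    nlinarith [mul_pos_of_neg_of_neg hc (neg_lt_zero.2 hpa)]
  have hPne1 : impliedProb μ f a ≠ 1 := by
    intro hP
    simp only [hP] at hopt
    have z1 : d1 μ f = 0 := by
      refine setIntegral_eq_zero_of_forall_eq_zero fun p hp => (hopt p hp).1 ?_
      obtain ⟨p0, p1⟩ := hp
      norm_num
      nlinarith
    have z2 : d2 μ f = 0 := by
      refine setIntegral_eq_zero_of_forall_eq_zero fun p hp => (hopt p hp).2.1 ?_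
      simp
    have za : a.2 = 0 := by
      have := hP
      unfold impliedProb at this
      rw [div_eq_one_iff_eq hpos.ne'] at this
      linarith
    have hpa : 0 < a.1 := by linarith
    have := atomic_opt κ q w μ f a hκ hq z1 z2 hat (a.1 / 2) 0 (by linarith) le_rfl
      (by linarith) (by linarith)
    rw [hP, za, add_zero, div_self (by positivity)] at this
    simp [payoff] at this
    have hc : κ * q - 1 < 0 := by nlinarith
    nlinarith [mul_pos_of_neg_of_neg hc (neg_lt_zero.2 hpa)]
  generalize impliedProb μ f a = P at *
  have P0 : 0 < P := lt_of_le_of_ne hP0 hPne0.symm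
  have P1 : P < 1 := lt_of_le_of_ne hP1 hPne1
  have P1' : 0 < 1 - P := by linarith
  simp only [if_neg hPne0, if_neg hPne1] at hopt
  have hatom : ∀ x : ℝ, ∀ᵐ p ∂(μ.restrict (Icc (0:ℝ) 1)), p ≠ x := by
    intro x
    apply ae_restrict_of_ae
    obtain ⟨g, -, -, rfl⟩ := hμ
    apply (withDensity_absolutelyContinuous _ _).ae_le
    apply ae_restrict_of_ae
    exact Measure.ae_ne volume x
  have cu : ∀ p, P < κ * p → 0 < κ * p / P - 1 := fun p hp => by
    rw [sub_pos, lt_div_iff₀ P0]; linarith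
  have cu' : ∀ p, κ * p < P → κ * p / P - 1 < 0 := fun p hp => by
    rw [sub_neg, div_lt_iff₀ P0]; linarith
  have cv : ∀ p, 1 - P < κ * (1 - p) → 0 < κ * (1 - p) / (1 - P) - 1 := fun p hp => by
    rw [sub_pos, lt_div_iff₀ P1']; linarith
  have cv' : ∀ p, κ * (1 - p) < 1 - P → κ * (1 - p) / (1 - P) - 1 < 0 := fun p hp => by
    rw [sub_neg, div_lt_iff₀ P1']; linarith
  constructor
  · have hsub : Ioc (P / κ) 1 ⊆ Icc (0:ℝ) 1 := fun p hp =>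
      ⟨(div_nonneg hP0 k0.le).trans hp.1.le, hp.2⟩
    have e : d1 μ f = ∫ p in Icc (0:ℝ) 1, (Ioc (P / κ) 1).indicator (fun _ => (1:ℝ)) p ∂μ := by
      unfold d1
      apply integral_congr_ae
      filter_upwards [hatom (P / κ), ae_restrict_mem measurableSet_Icc] with p hne hp
      obtain ⟨p0, p1⟩ := id hp
      rcases lt_or_gt_of_ne hne with hlt | hgt
      · rw [indicator_of_notMem (fun hh => absurd hh.1 (not_lt.2 hlt.le))]
        rw [lt_div_iff₀ k0] at hlt
        exact (hopt p hp).1 (cu' p (by linarith))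
      · rw [indicator_of_mem (show p ∈ Ioc (P / κ) 1 from ⟨hgt, p1⟩)]
        rw [div_lt_iff₀ k0] at hgt
        exact (hopt p hp).2.2.1 (cu p (by linarith)) (cv' p (by nlinarith))
    rw [e, setIntegral_indicator measurableSet_Ioc, inter_eq_self_of_subset_right hsub]
    simp [Measure.real]
  · have hsub : Ico 0 (1 - (1 - P) / κ) ⊆ Icc (0:ℝ) 1 := fun p hp =>
      ⟨hp.1, by have := hp.2; have := div_nonneg P1'.le k0.le; linarith⟩
    have e : d2 μ f = ∫ p in Icc (0:ℝ) 1,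
        (Ico 0 (1 - (1 - P) / κ)).indicator (fun _ => (1:ℝ)) p ∂μ := by
      unfold d2
      apply integral_congr_ae
      filter_upwards [hatom (1 - (1 - P) / κ), ae_restrict_mem measurableSet_Icc] with p hne hp
      obtain ⟨p0, p1⟩ := id hp
      rcases lt_or_gt_of_ne hne with hlt | hgt
      · rw [indicator_of_mem (show p ∈ Ico 0 (1 - (1 - P) / κ) from ⟨p0, hlt⟩)]
        have hlt' : (1 - P) / κ < 1 - p := by linarith
        rw [div_lt_iff₀ k0] at hlt'
        exact (hopt p hp).2.2.2 (cv p (by linarith)) (cu' p (by nlinarith))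
      · rw [indicator_of_notMem (fun hh => absurd hh.2 (not_lt.2 hgt.le))]
        have hgt' : 1 - p < (1 - P) / κ := by linarith
        rw [lt_div_iff₀ k0] at hgt'
        exact (hopt p hp).2.1 (cv' p (by linarith))
    rw [e, setIntegral_indicator measurableSet_Ico, inter_eq_self_of_subset_right hsub]
    simp [Measure.real]
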